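/- Fix integers n, d, e with 1 ≤ d ≤ n−1 and e ≥ 0. Then there exists a polynomial P with non-negative integer coefficients such that for every power q of an odd prime, the number of irreducible characters of R_u^{U,d} (defined over 𝔽_{q²}) of degree (q²)^e equals P(q−1). -/

import Mathlib

open Matrix

namespace UnitaryUnipotentRadical

/-- Index type for `2n×2n` matrices, split as `d + (n−d) + (n−d) + d`. -/
abbrev κ (n d : ℕ) := (Fin d ⊕ Fin (n - d)) ⊕ (Fin (n - d) ⊕ Fin d)

/-- The `m × m` matrix with `1`'s on the antidiagonal and `0`'s elsewhere. -/
def antidiagMat (F : Type) [Field F] (m : ℕ) : Matrix (Fin m) (Fin m) F :=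
  Matrix.of fun i j => if (i : ℕ) + (j : ℕ) = m - 1 then 1 else 0

/-- The antidiagonal matrix `J_{2n}`, written in block form with respect to the
partition `d + (n−d) + (n−d) + d`. -/
def J2n (F : Type) [Field F] (n d : ℕ) : Matrix (κ n d) (κ n d) F :=
  Matrix.fromBlocks 0
    (Matrix.fromBlocks 0 (antidiagMat F d) (antidiagMat F (n - d)) 0)
    (Matrix.fromBlocks 0 (antidiagMat F (n - d)) (antidiagMat F d) 0) 0

/-- The level of an index with respect to the three-block partition `d + (2n−2d) + d`. -/
def lvl (n d : ℕ) : κ n d → ℕ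
  | Sum.inl (Sum.inl _) => 0
  | Sum.inl (Sum.inr _) => 1
  | Sum.inr (Sum.inl _) => 1
  | Sum.inr (Sum.inr _) => 2

/-- `R_u^{U,d}`: elements of `U_{2n}(q²)` of the form `[[I_d, X, Y],[0, I_{2n−2d}, Z],
[0, 0, I_d]]` with respect to the partition `d + (2n−2d) + d`. -/
def RuU (q : ℕ) (F : Type) [Field F] (n d : ℕ) : Set (Matrix (κ n d) (κ n d) F) :=
  {g | (g.map (fun x => x ^ q))ᵀ * J2n F n d * g = J2n F n d ∧
    (∀ i j, lvl n d j < lvl n d i → g i j = 0) ∧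
    (∀ i j, lvl n d i = lvl n d j → g i j = if i = j then 1 else 0)}

/-- `A^U`. -/
def AU (q : ℕ) (F : Type) [Field F] (n d : ℕ) : Set (Matrix (κ n d) (κ n d) F) :=
  {g | ∃ (B1 : Matrix (Fin d) (Fin (n - d)) F) (B2 : Matrix (Fin d) (Fin d) F)
      (B3 : Matrix (Fin (n - d)) (Fin d) F),
    B1 = -(antidiagMat F d) * (B3.map (fun x => x ^ q))ᵀ * antidiagMat F (n - d) ∧
    B2 = -(antidiagMat F d) * (B2.map (fun x => x ^ q))ᵀ * antidiagMat F d ∧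
    g = Matrix.fromBlocks 1 (Matrix.fromBlocks B1 B2 0 B3) 0 1}

/-- `H^U`. -/
def HU (q : ℕ) (F : Type) [Field F] (n d : ℕ) : Set (Matrix (κ n d) (κ n d) F) :=
  {g | ∃ (A1 : Matrix (Fin d) (Fin (n - d)) F) (A2 : Matrix (Fin (n - d)) (Fin d) F),
    A1 = -(antidiagMat F d) * (A2.map (fun x => x ^ q))ᵀ * antidiagMat F (n - d) ∧
    g = Matrix.fromBlocks (Matrix.fromBlocks 1 A1 0 1) 0 0 (Matrix.fromBlocks 1 A2 0 1)}

section Characters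

open CategoryTheory

/-- Coordinates on a group of nilpotency class two: `G` is the central extension of `W` by `T`
given by an alternating biadditive cocycle `c`. -/
structure HeisenbergCoords (G W T : Type) [Group G] [AddCommGroup W] [AddCommGroup T] where
  /-- the coordinates of an element -/
  equiv : G ≃ W × T
  /-- the cocycle -/
  c : W →+ W →+ T
  c_swap : ∀ x y, c y x = -c x y
  exists_half : ∀ x : W, ∃ y, y + y = x
  equiv_mul : ∀ g h, equiv (g * h) =
    ((equiv g).1 + (equiv h).1, (equiv g).2 + (equiv h).2 + c (equiv g).1 (equiv h).1)

namespace HeisenbergCoords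

variable {G W T : Type} [Group G] [AddCommGroup W] [AddCommGroup T] (E : HeisenbergCoords G W T)

/-- The radical of the form obtained by composing the cocycle with a character of the centre. -/
def rad (l : AddChar T ℂ) : AddSubgroup W where
  carrier := {x | ∀ y, l (E.c x y) = 1}
  zero_mem' y := by simp
  add_mem' {a b} ha hb y := by simp [AddChar.map_add_eq_mul, ha y, hb y]
  neg_mem' {a} ha y := by simp [AddChar.map_neg_eq_inv, ha y]

lemma mem_rad {l : AddChar T ℂ} {x : W} : x ∈ E.rad l ↔ ∀ y, l (E.c x y) = 1 := Iff.rfl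

open Classical in
/-- The normalised character attached to `l` and `m`, extended by zero. -/
noncomputable def scalar (l : AddChar T ℂ) (m : AddChar (E.rad l) ℂ) (g : G) : ℂ :=
  if h : (E.equiv g).1 ∈ E.rad l then l (E.equiv g).2 * m ⟨_, h⟩ else 0

variable {E}

lemma equiv_one : E.equiv 1 = 0 := by
  have h := E.equiv_mul 1 1
  rw [mul_one] at h
  have h1 : (E.equiv 1).1 = 0 := by simpa using congrArg Prod.fst h
  have h2 : (E.equiv 1).2 = 0 := by simpa [h1] using congrArg Prod.snd h
  exact Prod.ext h1 h2

lemma fst_mul (g h : G) : (E.equiv (g * h)).1 = (E.equiv g).1 + (E.equiv h).1 := by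
  rw [E.equiv_mul]

lemma snd_mul (g h : G) : (E.equiv (g * h)).2 =
    (E.equiv g).2 + (E.equiv h).2 + E.c (E.equiv g).1 (E.equiv h).1 := by
  rw [E.equiv_mul]

lemma fst_inv (g : G) : (E.equiv g⁻¹).1 = -(E.equiv g).1 := by
  have h := fst_mul (E := E) g⁻¹ g
  rw [inv_mul_cancel, equiv_one] at h
  exact eq_neg_of_add_eq_zero_left h.symm

lemma scalar_of_mem {l : AddChar T ℂ} {m : AddChar (E.rad l) ℂ} {g : G}
    (h : (E.equiv g).1 ∈ E.rad l) : E.scalar l m g = l (E.equiv g).2 * m ⟨_, h⟩ := by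
  simp [scalar, h]

lemma scalar_of_notMem {l : AddChar T ℂ} {m : AddChar (E.rad l) ℂ} {g : G}
    (h : (E.equiv g).1 ∉ E.rad l) : E.scalar l m g = 0 := by
  simp [scalar, h]

lemma scalar_mul {l : AddChar T ℂ} {m : AddChar (E.rad l) ℂ} {g h : G}
    (hg : (E.equiv g).1 ∈ E.rad l) (hh : (E.equiv h).1 ∈ E.rad l) :
    E.scalar l m (g * h) = E.scalar l m g * E.scalar l m h := by
  have hgh : (E.equiv (g * h)).1 ∈ E.rad l := by rw [fst_mul]; exact add_mem hg hh
  have e : (⟨_, hgh⟩ : E.rad l) = ⟨_, hg⟩ + ⟨_, hh⟩ := Subtype.ext (fst_mul g h)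
  rw [scalar_of_mem hg, scalar_of_mem hh, scalar_of_mem hgh, e, snd_mul]
  simp only [AddChar.map_add_eq_mul, hg (E.equiv h).1]
  ring

lemma scalar_one {l : AddChar T ℂ} {m : AddChar (E.rad l) ℂ} : E.scalar l m 1 = 1 := by
  have h : (E.equiv 1).1 ∈ E.rad l := by rw [equiv_one]; exact zero_mem _
  have e : (⟨_, h⟩ : E.rad l) = 0 := Subtype.ext (congrArg Prod.fst equiv_one)
  rw [scalar_of_mem h, e, equiv_one]; simp

lemma scalar_mul_inv {l : AddChar T ℂ} {m : AddChar (E.rad l) ℂ} {g : G}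
    (hg : (E.equiv g).1 ∈ E.rad l) : E.scalar l m g * E.scalar l m g⁻¹ = 1 := by
  rw [← scalar_mul hg (by rw [fst_inv]; exact neg_mem hg), mul_inv_cancel, scalar_one]

/-- Exchanging two elements costs a central factor. -/
lemma mul_eq_mul_mul (g h : G) :
    g * h = h * g * E.equiv.symm (0, E.c (E.equiv g).1 (E.equiv h).1 +
      E.c (E.equiv g).1 (E.equiv h).1) := by
  apply E.equiv.injective
  rw [E.equiv_mul, E.equiv_mul, E.equiv_mul]
  simp only [Equiv.apply_symm_apply, add_zero, map_zero]
  rw [E.c_swap (E.equiv g).1 (E.equiv h).1]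
  ext
  · exact add_comm _ _
  · simp only; abel

lemma scalar_conj {l : AddChar T ℂ} {m : AddChar (E.rad l) ℂ} {r : G} (g : G)
    (hr : (E.equiv r).1 ∈ E.rad l) : E.scalar l m (g * r * g⁻¹) = E.scalar l m r := by
  set z := E.equiv.symm (0, E.c (E.equiv g).1 (E.equiv r).1 + E.c (E.equiv g).1 (E.equiv r).1)
  have hz : (E.equiv z).1 ∈ E.rad l := by simp [z, zero_mem]
  have hz1 : E.scalar l m z = 1 := by
    have e : (⟨_, hz⟩ : E.rad l) = 0 := Subtype.ext (by simp [z])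
    rw [scalar_of_mem hz, e]
    simp [z, AddChar.map_add_eq_mul, E.c_swap (E.equiv r).1 (E.equiv g).1,
      AddChar.map_neg_eq_inv, hr (E.equiv g).1]
  have hzc : z * g⁻¹ = g⁻¹ * z := by
    rw [mul_eq_mul_mul (E := E) z g⁻¹]
    simp only [z, Equiv.apply_symm_apply, map_zero, AddMonoidHom.zero_apply, add_zero]
    have : E.equiv.symm ((0 : W), (0 : T)) = 1 := by
      rw [Equiv.symm_apply_eq, equiv_one]; rfl
    rw [this, mul_one]
  rw [mul_eq_mul_mul (E := E) g r]
  change E.scalar l m (r * g * z * g⁻¹) = _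
  rw [mul_assoc, hzc, ← mul_assoc, mul_inv_cancel_right, scalar_mul hr hz, hz1, mul_one]

/-- If an element commutes with the whole group in a simple representation it acts as a scalar. -/
lemma exists_eq_smul_one {V : FDRep ℂ G} [Simple V] {g : G}
    (hg : ∀ h, V.ρ g * V.ρ h = V.ρ h * V.ρ g) : ∃ a : ℂ, V.ρ g = a • 1 := by
  let f : V ⟶ V := ⟨Action.ρ V g, fun h => by ext x; exact DFunLike.congr_fun (hg h) x⟩
  obtain ⟨a, ha⟩ := endomorphism_simple_eq_smul_id ℂ f
  exact ⟨a, (congrArg (fun k : V ⟶ V => k.hom.hom.hom) ha).symm⟩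

lemma finrank_ne_zero (V : FDRep ℂ G) [Simple V] : Module.finrank ℂ V ≠ 0 := by
  intro h
  have : Subsingleton V := Module.finrank_zero_iff.mp h
  refine Simple.not_isZero V ((Limits.IsZero.iff_id_eq_zero _).2 ?_)
  ext x
  exact Subsingleton.elim (α := V) _ _

lemma injective_of_mono {V Y : FDRep ℂ G} (f : Y ⟶ V) [Mono f] :
    Function.Injective f.hom.hom.hom := by
  have : Mono ((forget₂ (FDRep ℂ G) (Rep ℂ G)).map f) := inferInstance
  exact (Rep.mono_iff_injective _).1 this

lemma isIso_of_bijective {V Y : FDRep ℂ G} (f : Y ⟶ V)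
    (h : Function.Bijective f.hom.hom.hom) : IsIso f := by
  have : IsIso f.hom := by
    let e := (LinearEquiv.ofBijective f.hom.hom.hom h).toFGModuleCatIso
    have : f.hom = e.hom := rfl
    rw [this]; infer_instance
  exact Action.isIso_of_hom_isIso f

/-- Some simple representation lies over every pair of characters. -/
lemma exists_simple [Finite G] (l : AddChar T ℂ) (m : AddChar (E.rad l) ℂ) :
    ∃ V : FDRep ℂ G, Simple V ∧
      ∀ r, (E.equiv r).1 ∈ E.rad l → V.ρ r = E.scalar l m r • 1 := by
  let S : Submodule ℂ (G → ℂ) :=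
    { carrier := {f | ∀ r, (E.equiv r).1 ∈ E.rad l → ∀ g, f (r * g) = E.scalar l m r * f g}
      zero_mem' := fun r _ g => by simp
      add_mem' := fun {a b} ha hb r hr g => by simp [ha r hr g, hb r hr g, mul_add]
      smul_mem' := fun c a ha r hr g => by simp [ha r hr g, mul_left_comm] }
  let R : Representation ℂ G S :=
    { toFun := fun h =>
        { toFun := fun f => ⟨fun g => f.1 (g * h), fun r hr g => by
            simpa [mul_assoc] using f.2 r hr (g * h)⟩
          map_add' := fun _ _ => rfl
          map_smul' := fun _ _ => rfl }
      map_one' := by ext f g; simp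
      map_mul' := fun a b => by ext f g; simp [mul_assoc] }
  have hR : ∀ r, (E.equiv r).1 ∈ E.rad l → R r = E.scalar l m r • 1 := by
    intro r hr
    ext f g
    have hc : (E.equiv (g * r * g⁻¹)).1 ∈ E.rad l := by
      rw [fst_mul, fst_mul, fst_inv]; simpa using hr
    have := f.2 _ hc g
    rw [scalar_conj g hr, inv_mul_cancel_right] at this
    simpa [R] using this
  have hS : Module.finrank ℂ S ≠ 0 := by
    intro h
    have : Subsingleton S := Module.finrank_zero_iff.mp h
    let f : S := ⟨E.scalar l m, fun r hr g => by
      by_cases hg : (E.equiv g).1 ∈ E.rad l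
      · exact scalar_mul hr hg
      · rw [scalar_of_notMem hg, scalar_of_notMem, mul_zero]
        rwa [fst_mul, add_mem_cancel_left hr]⟩
    have h1 : f.1 1 = (0 : S).1 1 := by rw [Subsingleton.elim f 0]
    exact one_ne_zero ((scalar_one (E := E) (m := m)).symm.trans h1)
  let Pr : FDRep ℂ G → Prop := fun V => Module.finrank ℂ V ≠ 0 ∧
    ∀ r, (E.equiv r).1 ∈ E.rad l → V.ρ r = E.scalar l m r • 1
  have hex : ∃ k, ∃ V, Pr V ∧ Module.finrank ℂ V = k := ⟨_, FDRep.of R, ⟨hS, hR⟩, rfl⟩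
  classical
  obtain ⟨V, ⟨hV0, hV⟩, hk⟩ := Nat.find_spec hex
  refine ⟨V, ⟨fun {Y} f _ => ⟨?_, ?_⟩⟩, hV⟩
  · rintro h rfl
    have : Subsingleton V := by
      obtain ⟨g, -, hg⟩ := h.out
      refine ⟨fun x y => ?_⟩
      have hx : ∀ x : V, x = 0 := fun x =>
        (LinearMap.congr_fun (congrArg (fun k : V ⟶ V => k.hom.hom.hom) hg) x).symm.trans (by simp)
      rw [hx x, hx y]
    exact hV0 (Module.finrank_zero_of_subsingleton)
  · intro hf
    have hinj := injective_of_mono f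
    have hY : Pr Y := by
      refine ⟨fun h => hf ?_, fun r hr => ?_⟩
      · have : Subsingleton Y := Module.finrank_zero_iff.mp h
        ext x
        have : x = 0 := Subsingleton.elim (α := Y) _ _
        rw [this]; simp
      · ext x
        apply hinj
        have := LinearMap.congr_fun (congrArg (fun k => k.hom.hom) (f.comm r)) x
        refine this.trans ?_
        change V.ρ r (f.hom.hom.hom x) = _
        rw [hV r hr]
        simp
    have hle : Module.finrank ℂ V ≤ Module.finrank ℂ Y := by
      rw [hk]; exact Nat.find_min' hex ⟨Y, hY, rfl⟩
    refine isIso_of_bijective f ⟨hinj, ?_⟩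
    exact (LinearMap.injective_iff_surjective_of_finrank_eq_finrank
      (le_antisymm (LinearMap.finrank_le_finrank_of_injective hinj) hle)).1 hinj

section Simple

variable {V : FDRep ℂ G}

/-- A simple representation determines a pair of characters, and its own character is supported on
the radical. -/
lemma exists_scalar_of_simple [Simple V] :
    ∃ (l : AddChar T ℂ) (m : AddChar (E.rad l) ℂ), ∀ g,
      V.character g = Module.finrank ℂ V * E.scalar l m g := by
  have hD : (Module.finrank ℂ V : ℂ) ≠ 0 := Nat.cast_ne_zero.2 (finrank_ne_zero V)
  let s : G → ℂ := fun g => V.character g / Module.finrank ℂ V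
  have hs_mul : ∀ {g h : G}, V.ρ g = s g • 1 → s (g * h) = s g * s h := by
    intro g h hg
    generalize s g = a at hg ⊢
    simp only [s, FDRep.character, map_mul, hg, smul_mul_assoc, one_mul, map_smul, smul_eq_mul]
    field_simp
  have hs : ∀ {g : G} {a : ℂ}, V.ρ g = a • 1 → V.ρ g = s g • 1 := by
    intro g a h
    suffices s g = a by rw [this, h]
    simp only [s, FDRep.character, h, map_smul, LinearMap.trace_one, smul_eq_mul]
    field_simp
  have hs_one : s 1 = 1 := by simp [s, hD]
  have hz : ∀ z : T, V.ρ (E.equiv.symm (0, z)) = s (E.equiv.symm (0, z)) • 1 := by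
    intro z
    obtain ⟨a, ha⟩ := exists_eq_smul_one (V := V) (g := E.equiv.symm (0, z)) fun h => by
      rw [← map_mul, ← map_mul, mul_eq_mul_mul (E := E)]
      simp only [Equiv.apply_symm_apply, map_zero, AddMonoidHom.zero_apply, add_zero]
      rw [show E.equiv.symm ((0 : W), (0 : T)) = 1 by
        rw [Equiv.symm_apply_eq, equiv_one]; rfl, mul_one]
    exact hs ha
  have h0 : E.equiv.symm ((0 : W), (0 : T)) = 1 := by rw [Equiv.symm_apply_eq, equiv_one]; rfl
  let l : AddChar T ℂ :=
    { toFun := fun z => s (E.equiv.symm (0, z))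
      map_zero_eq_one' := by rw [h0, hs_one]
      map_add_eq_mul' := fun x y => by
        rw [← hs_mul (hz x)]
        congr 1
        rw [Equiv.symm_apply_eq, E.equiv_mul]
        simp }
  have hrad : ∀ g, (E.equiv g).1 ∈ E.rad l → V.ρ g = s g • 1 := by
    intro g hg
    obtain ⟨a, ha⟩ := exists_eq_smul_one (V := V) (g := g) fun h => by
      rw [← map_mul, ← map_mul, mul_eq_mul_mul (E := E) g h, map_mul _ (h * g), hz]
      change _ * (l _ • 1) = _
      rw [AddChar.map_add_eq_mul, hg]
      simp
    exact hs ha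
  have hsplit : ∀ x z, E.equiv.symm (x, z) = E.equiv.symm (0, z) * E.equiv.symm (x, 0) := by
    intro x z
    rw [Equiv.symm_apply_eq, E.equiv_mul]
    simp
  let m : AddChar (E.rad l) ℂ :=
    { toFun := fun x => s (E.equiv.symm (x.1, 0))
      map_zero_eq_one' := by rw [← hs_one, ← h0]; rfl
      map_add_eq_mul' := fun x y => by
        rw [← hs_mul (hrad _ (by simp))]
        have : E.equiv.symm (x.1, 0) * E.equiv.symm (y.1, 0) =
            E.equiv.symm (0, E.c x.1 y.1) * E.equiv.symm ((x + y).1, 0) := by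
          rw [← hsplit]
          apply E.equiv.injective
          rw [E.equiv_mul]
          simp
        rw [this, hs_mul (hz _)]
        change _ = l _ * _
        rw [x.2, one_mul] }
  refine ⟨l, m, fun g => ?_⟩
  by_cases hg : (E.equiv g).1 ∈ E.rad l
  · rw [scalar_of_mem hg]
    change _ = _ * (s _ * s _)
    rw [← hs_mul (hz _), ← hsplit]
    simp only [Prod.mk.eta, Equiv.symm_apply_apply, s]
    field_simp
  · rw [scalar_of_notMem hg, mul_zero]
    rw [mem_rad] at hg
    push Not at hg
    obtain ⟨y, hy⟩ := hg
    obtain ⟨x, rfl⟩ := E.exists_half y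
    set h := E.equiv.symm (x, 0)
    have h1 : V.character (h⁻¹ * (g * h)) = V.character g := by
      rw [FDRep.char_mul_comm, mul_inv_cancel_right]
    rw [mul_eq_mul_mul (E := E) g h, mul_assoc, inv_mul_cancel_left, FDRep.character, map_mul, hz]
      at h1
    change LinearMap.trace ℂ V (V.ρ g * (l _ • 1)) = _ at h1
    rw [← map_add] at h1
    simp only [h, Equiv.apply_symm_apply, mul_smul_comm, mul_one, map_smul, smul_eq_mul] at h1
    by_contra hne
    exact hy (mul_right_cancel₀ hne (h1.trans (one_mul _).symm))

lemma sq_finrank_mul_card_rad [Finite G] [Finite W] [Finite T] [Simple V] {l : AddChar T ℂ}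
    {m : AddChar (E.rad l) ℂ}
    (h : ∀ g, V.character g = Module.finrank ℂ V * E.scalar l m g) :
    Module.finrank ℂ V ^ 2 * Nat.card (E.rad l) = Nat.card W := by
  classical
  have := Fintype.ofFinite G
  have := Fintype.ofFinite W
  have := Fintype.ofFinite T
  have hn := (FDRep.simple_iff_char_is_norm_one V).1 inferInstance
  have hterm : ∀ g, V.character g * V.character g⁻¹ =
      if (E.equiv g).1 ∈ E.rad l then (Module.finrank ℂ V : ℂ) ^ 2 else 0 := by
    intro g
    split_ifs with hg
    · rw [h, h, mul_mul_mul_comm, scalar_mul_inv hg]; ring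
    · rw [h g, scalar_of_notMem hg]; ring
  simp_rw [hterm] at hn
  rw [← E.equiv.symm.sum_comp, Fintype.sum_prod_type] at hn
  simp only [Equiv.apply_symm_apply, Finset.sum_const, Finset.card_univ] at hn
  rw [← Finset.smul_sum, ← Finset.sum_filter, Finset.sum_const] at hn
  have hG : Fintype.card G = Fintype.card W * Fintype.card T := by
    rw [Fintype.card_congr E.equiv, Fintype.card_prod]
  have hc : (Finset.univ.filter fun x => x ∈ E.rad l).card = Nat.card (E.rad l) := by
    rw [Nat.card_eq_fintype_card, Fintype.card_subtype]
  rw [hc] at hn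
  have hT : (Fintype.card T : ℂ) ≠ 0 := Nat.cast_ne_zero.2 Fintype.card_ne_zero
  simp only [hG, Nat.card_eq_fintype_card, nsmul_eq_mul] at hn
  rw [Nat.card_eq_fintype_card, Nat.card_eq_fintype_card]
  have : (Fintype.card T : ℂ) * ((Module.finrank ℂ V : ℂ) ^ 2 * Fintype.card (E.rad l)) =
    Fintype.card T * Fintype.card W := by push_cast at hn; linear_combination hn
  exact_mod_cast mul_left_cancel₀ hT this

end Simple

lemma eq_of_scalar_eq {l l' : AddChar T ℂ} {m : AddChar (E.rad l) ℂ} {m' : AddChar (E.rad l') ℂ}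
    (h : ∀ r, (E.equiv r).1 ∈ E.rad l → E.scalar l m r = E.scalar l' m' r) :
    (⟨l, m⟩ : Σ l : AddChar T ℂ, AddChar (E.rad l) ℂ) = ⟨l', m'⟩ := by
  have hll : l' = l := by
    ext z
    have h1 := h (E.equiv.symm (0, z)) (by simp [zero_mem])
    rw [scalar_of_mem (by simp [zero_mem]), scalar_of_mem (by simp [zero_mem])] at h1
    have e : ∀ l : AddChar T ℂ, ∀ h : (E.equiv (E.equiv.symm (0, z))).1 ∈ E.rad l,
      (⟨_, h⟩ : E.rad l) = 0 := fun l h => Subtype.ext (by simp)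
    rw [e, e] at h1
    simpa using h1.symm
  subst hll
  have hmm : m' = m := by
    ext x
    have hx : (E.equiv (E.equiv.symm (x.1, 0))).1 ∈ E.rad l' := by simp
    have h1 := h (E.equiv.symm (x.1, 0)) hx
    rw [scalar_of_mem hx, scalar_of_mem hx] at h1
    simpa using h1.symm
  rw [hmm]

/-- The irreducible characters of degree `D` are parametrised by the characters of the centre whose
radical has the right size, together with a character of that radical. -/
theorem card_irreducible_characters [Finite G] [Finite W] [Finite T]
    (E : HeisenbergCoords G W T) (D : ℕ) :
    Nat.card {χ : G → ℂ | (∃ V : FDRep ℂ G, Simple V ∧ FDRep.character V = χ) ∧ χ 1 = D} =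
      Nat.card (Σ l : {l : AddChar T ℂ // D ^ 2 * Nat.card (E.rad l) = Nat.card W},
        E.rad l.1) := by
  have hfin : ∀ l : AddChar T ℂ, Nonempty (E.rad l ≃ AddChar (E.rad l) ℂ) := fun l => by
    have := Fintype.ofFinite (E.rad l)
    exact ⟨Fintype.equivOfCardEq AddChar.card_eq.symm⟩
  rw [Nat.card_congr (Equiv.sigmaCongrRight fun l :
    {l : AddChar T ℂ // D ^ 2 * Nat.card (E.rad l) = Nat.card W} => (hfin l.1).some)]
  symm
  refine Nat.card_eq_of_bijective
    (fun a => ⟨fun g => D * E.scalar a.1.1 a.2 g, ?_, ?_⟩) ⟨?_, ?_⟩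
  · obtain ⟨⟨l, hl⟩, m⟩ := a
    obtain ⟨V, hV, hVs⟩ := exists_simple (E := E) l m
    refine ⟨V, hV, ?_⟩
    obtain ⟨l', m', hV'⟩ := exists_scalar_of_simple (E := E) (V := V)
    have hD0 : (Module.finrank ℂ V : ℂ) ≠ 0 := Nat.cast_ne_zero.2 (finrank_ne_zero V)
    have hch : ∀ r, (E.equiv r).1 ∈ E.rad l →
        V.character r = Module.finrank ℂ V * E.scalar l m r := fun r hr => by
      rw [FDRep.character, hVs r hr, map_smul, LinearMap.trace_one, smul_eq_mul, mul_comm]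
    have heq := eq_of_scalar_eq (m := m) (m' := m') fun r hr =>
      mul_left_cancel₀ hD0 ((hch r hr).symm.trans (hV' r))
    cases heq
    have hsq := (sq_finrank_mul_card_rad hV').trans hl.symm
    have : Module.finrank ℂ V = D :=
      Nat.pow_left_injective (n := 2) two_ne_zero (Nat.eq_of_mul_eq_mul_right Nat.card_pos hsq)
    ext g
    rw [hV', this]
  · simp [scalar_one]
  · rintro ⟨⟨l, hl⟩, m⟩ ⟨⟨l', hl'⟩, m'⟩ h
    have hD0 : (D : ℂ) ≠ 0 := by
      rintro h0
      rw [Nat.cast_eq_zero] at h0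
      simp [h0] at hl
      exact Nat.card_pos.ne hl
    have hch : ∀ r, E.scalar l m r = E.scalar l' m' r := fun r =>
      mul_left_cancel₀ hD0 (congrFun (congrArg Subtype.val h) r)
    cases eq_of_scalar_eq fun r _ => hch r
    rfl
  · rintro ⟨χ, ⟨V, hV, rfl⟩, hD⟩
    obtain ⟨l, m, h⟩ := exists_scalar_of_simple (E := E) (V := V)
    have hDV : Module.finrank ℂ V = D := by
      rw [FDRep.char_one] at hD
      exact_mod_cast hD
    refine ⟨⟨⟨l, ?_⟩, m⟩, Subtype.ext (funext fun g => ?_)⟩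
    · rw [← hDV]; exact sq_finrank_mul_card_rad h
    · simp only [h, hDV]

end HeisenbergCoords

end Characters

section HermitianCount

variable {F : Type} [Field F] [Finite F] [StarRing F]

/-- The dimension of the kernel of a square matrix. -/
noncomputable def corank {d : ℕ} (H : Matrix (Fin d) (Fin d) F) : ℕ :=
  Module.finrank F (LinearMap.ker H.mulVecLin)

omit [Finite F] [StarRing F] in
lemma card_ker {d : ℕ} (H : Matrix (Fin d) (Fin d) F) :
    Nat.card {y : Fin d → F // H *ᵥ y = 0} = Nat.card F ^ corank H :=
  Module.natCard_eq_pow_finrank (K := F) (V := LinearMap.ker H.mulVecLin)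

omit [Finite F] [StarRing F] in
lemma corank_le {d : ℕ} (H : Matrix (Fin d) (Fin d) F) : corank H ≤ d := by
  simpa [corank] using (LinearMap.ker H.mulVecLin).finrank_le

omit [Finite F] [StarRing F] in
lemma card_range {d : ℕ} (H : Matrix (Fin d) (Fin d) F) :
    Nat.card {b : Fin d → F // ∃ c, H *ᵥ c = b} = Nat.card F ^ (d - corank H) := by
  have h := H.mulVecLin.finrank_range_add_finrank_ker
  rw [Module.finrank_fin_fun] at h
  have h' : Module.finrank F (LinearMap.range H.mulVecLin) = d - corank H := by
    rw [corank]; omega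
  rw [← h']
  exact Module.natCard_eq_pow_finrank (K := F) (V := LinearMap.range H.mulVecLin)

/-- Border a matrix by a Hermitian row and column. -/
def border {d : ℕ} (a : F) (b : Fin d → F) (H : Matrix (Fin d) (Fin d) F) :
    Matrix (Fin (d + 1)) (Fin (d + 1)) F :=
  Matrix.of (Fin.cons (Fin.cons a (star b)) fun i => Fin.cons (b i) (H i))

omit [Finite F] in
lemma border_mulVec {d : ℕ} (a : F) (b : Fin d → F) (H : Matrix (Fin d) (Fin d) F) (x : F)
    (y : Fin d → F) : border a b H *ᵥ (Fin.cons x y : Fin (d + 1) → F) =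
      (Fin.cons (a * x + star b ⬝ᵥ y) (x • b + H *ᵥ y) : Fin (d + 1) → F) := by
  ext i
  refine Fin.cases ?_ (fun i => ?_) i <;>
    simp [border, Matrix.mulVec, dotProduct, Fin.sum_univ_succ, mul_comm]

omit [Finite F] in
lemma border_mulVec_eq_zero {d : ℕ} {a : F} {b : Fin d → F} {H : Matrix (Fin d) (Fin d) F}
    {x : F} {y : Fin d → F} : border a b H *ᵥ (Fin.cons x y : Fin (d + 1) → F) = 0 ↔
      a * x + star b ⬝ᵥ y = 0 ∧ x • b + H *ᵥ y = 0 := by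
  rw [border_mulVec, ← Matrix.cons_zero_zero]
  exact Fin.cons_inj

omit [Finite F] in
lemma border_isHermitian {d : ℕ} {a : F} {b : Fin d → F} {H : Matrix (Fin d) (Fin d) F} :
    (border a b H).IsHermitian ↔ star a = a ∧ H.IsHermitian := by
  simp only [Matrix.IsHermitian.ext_iff, Fin.forall_fin_succ]
  simp [border]

/-- The corank of a bordered matrix whose border lies in the range. -/
lemma corank_border_of_mem [DecidableEq F] {d : ℕ} (a : F) (c : Fin d → F)
    {H : Matrix (Fin d) (Fin d) F} (hH : H.IsHermitian) :
    corank (border a (H *ᵥ c) H) = corank H + if a = star c ⬝ᵥ H *ᵥ c then 1 else 0 := by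
  have hs : ∀ y, star (H *ᵥ c) ⬝ᵥ y = star c ⬝ᵥ H *ᵥ y := fun y => by
    rw [star_mulVec, hH.eq, ← dotProduct_mulVec]
  let e : {v : Fin (d + 1) → F // border a (H *ᵥ c) H *ᵥ v = 0} ≃
      {y : Fin d → F // H *ᵥ y = 0} × {x : F // (a - star c ⬝ᵥ H *ᵥ c) * x = 0} :=
    { toFun := fun v =>
        have hv := v.2
        have h : a * v.1 0 + star (H *ᵥ c) ⬝ᵥ Fin.tail v.1 = 0 ∧
            v.1 0 • (H *ᵥ c) + H *ᵥ Fin.tail v.1 = 0 := by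
          rwa [← Fin.cons_self_tail v.1, border_mulVec_eq_zero] at hv
        (⟨Fin.tail v.1 + v.1 0 • c, by
          rw [mulVec_add, mulVec_smul, add_comm]; exact h.2⟩, ⟨v.1 0, by
          have h1 := h.1
          rw [hs, eq_neg_of_add_eq_zero_right h.2, dotProduct_neg, dotProduct_smul,
            smul_eq_mul] at h1
          linear_combination h1⟩)
      invFun := fun p => ⟨Fin.cons p.2.1 (p.1.1 - p.2.1 • c), by
        rw [border_mulVec_eq_zero, hs, mulVec_sub, p.1.2, mulVec_smul]
        refine ⟨?_, by simp⟩
        rw [zero_sub, dotProduct_neg, dotProduct_smul, smul_eq_mul]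
        linear_combination p.2.2⟩
      left_inv := fun v => Subtype.ext (by simp)
      right_inv := fun p => by simp }
  have hc := Nat.card_congr e
  rw [Nat.card_prod, card_ker, card_ker] at hc
  have hx : Nat.card {x : F // (a - star c ⬝ᵥ H *ᵥ c) * x = 0} =
      Nat.card F ^ (if a = star c ⬝ᵥ H *ᵥ c then 1 else 0) := by
    split_ifs with h
    · rw [pow_one]
      exact Nat.card_congr (Equiv.subtypeUnivEquiv fun x => by simp [h])
    · rw [pow_zero, Nat.card_eq_one_iff_unique]
      refine ⟨⟨fun x y => Subtype.ext ?_⟩, ⟨⟨0, by simp⟩⟩⟩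
      have := sub_ne_zero.2 h
      rw [(mul_eq_zero.1 x.2).resolve_left this, (mul_eq_zero.1 y.2).resolve_left this]
  rw [hx, ← pow_add] at hc
  exact Nat.pow_right_injective Finite.one_lt_card hc

omit [Finite F] in
/-- A vector orthogonal to the kernel of a Hermitian matrix lies in its range. -/
lemma exists_mulVec_eq_of_forall_ker {d : ℕ} {b : Fin d → F} {H : Matrix (Fin d) (Fin d) F}
    (hH : H.IsHermitian) (h : ∀ y, H *ᵥ y = 0 → star b ⬝ᵥ y = 0) : ∃ c, H *ᵥ c = b := by
  have hb : dotProductBilin F F (star b) ∈ (LinearMap.ker H.mulVecLin).dualAnnihilator := by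
    rw [Submodule.mem_dualAnnihilator]
    exact fun y hy => h y hy
  rw [← LinearMap.range_dualMap_eq_dualAnnihilator_ker] at hb
  obtain ⟨f, hf⟩ := hb
  obtain ⟨u, rfl⟩ := (dotProductEquiv F (Fin d)).surjective f
  have hbu : star b = u ᵥ* H := dotProduct_eq _ _ fun y => by
    rw [← dotProduct_mulVec]
    exact (LinearMap.congr_fun hf y).symm
  exact ⟨star u, by rw [← star_star b, hbu, star_vecMul, hH.eq]⟩

/-- The corank of a bordered matrix whose border does not lie in the range. -/
lemma corank_border_of_notMem {d : ℕ} (a : F) {b : Fin d → F}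
    {H : Matrix (Fin d) (Fin d) F} (hH : H.IsHermitian) (hb : ¬ ∃ c, H *ᵥ c = b) :
    corank (border a b H) + 1 = corank H := by
  have hx0 : ∀ (x : F) (y : Fin d → F), x • b + H *ᵥ y = 0 → x = 0 := by
    intro x y h
    by_contra hx
    refine hb ⟨-x⁻¹ • y, ?_⟩
    rw [mulVec_smul, eq_neg_of_add_eq_zero_right h]
    simp [smul_smul, hx]
  let f : LinearMap.ker H.mulVecLin →ₗ[F] F :=
    (dotProductBilin F F (star b)).comp (LinearMap.ker H.mulVecLin).subtype
  have hf : LinearMap.range f = ⊤ := by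
    refine LinearMap.range_eq_top.2 (LinearMap.surjective fun hf => hb ?_)
    exact exists_mulVec_eq_of_forall_ker hH fun y hy => LinearMap.congr_fun hf ⟨y, hy⟩
  let e : {v : Fin (d + 1) → F // border a b H *ᵥ v = 0} ≃ LinearMap.ker f :=
    { toFun := fun v =>
        have h : a * v.1 0 + star b ⬝ᵥ Fin.tail v.1 = 0 ∧
            v.1 0 • b + H *ᵥ Fin.tail v.1 = 0 := by
          have hv := v.2
          rwa [← Fin.cons_self_tail v.1, border_mulVec_eq_zero] at hv
        have h0 := hx0 _ _ h.2
        ⟨⟨Fin.tail v.1, by simpa [h0] using h.2⟩, by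
          have h1 := h.1
          rw [h0, mul_zero, zero_add] at h1
          exact h1⟩
      invFun := fun y => ⟨Fin.cons 0 y.1.1, by
        rw [border_mulVec_eq_zero]
        have h1 : H *ᵥ y.1.1 = 0 := y.1.2
        have h2 : star b ⬝ᵥ y.1.1 = 0 := y.2
        simp [h1, h2]⟩
      left_inv := fun v => Subtype.ext (by
        have h : v.1 0 = 0 := by
          have hv := v.2
          rw [← Fin.cons_self_tail v.1, border_mulVec_eq_zero] at hv
          exact hx0 _ _ hv.2
        conv_rhs => rw [← Fin.cons_self_tail v.1, h])
      right_inv := fun y => by simp }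
  have hc := Nat.card_congr e
  rw [card_ker, Module.natCard_eq_pow_finrank (K := F) (V := LinearMap.ker f)] at hc
  have h1 := Nat.pow_right_injective Finite.one_lt_card hc
  have h2 := f.finrank_range_add_finrank_ker
  rw [hf, finrank_top, Module.finrank_self] at h2
  rw [h1, corank]
  omega

omit [Finite F] in
lemma dotProduct_mulVec_mem_selfAdjoint {d : ℕ} {H : Matrix (Fin d) (Fin d) F}
    (hH : H.IsHermitian) (c : Fin d → F) : star c ⬝ᵥ H *ᵥ c ∈ selfAdjoint F := by
  rw [selfAdjoint.mem_iff, ← star_dotProduct, star_mulVec, hH.eq, ← dotProduct_mulVec]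

/-- The number of Hermitian borders giving a matrix of corank `k`, depending only on the order `q`
of the fixed field, the size `d` and the corank `j` of the matrix. -/
def borderCount (q d j k : ℕ) : ℕ :=
  q ^ (2 * (d - j)) * (if k = j then q - 1 else if k = j + 1 then 1 else 0) +
    (q ^ (2 * d) - q ^ (2 * (d - j))) * (if k + 1 = j then q else 0)

lemma card_border {q d : ℕ} (hq : Nat.card (selfAdjoint F) = q) (hF : Nat.card F = q ^ 2)
    {H : Matrix (Fin d) (Fin d) F} (hH : H.IsHermitian) (k : ℕ) :
    Nat.card {p : (Fin d → F) × selfAdjoint F // corank (border p.2.1 p.1 H) = k} =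
      borderCount q d (corank H) k := by
  classical
  have := Fintype.ofFinite F
  have := Fintype.ofFinite (selfAdjoint F)
  let e : {p : (Fin d → F) × selfAdjoint F // corank (border p.2.1 p.1 H) = k} ≃
      Σ b : Fin d → F, {a : selfAdjoint F // corank (border a.1 b H) = k} :=
    { toFun := fun p => ⟨p.1.1, p.1.2, p.2⟩
      invFun := fun p => ⟨(p.1, p.2.1), p.2.2⟩
      left_inv := fun _ => rfl
      right_inv := fun _ => rfl }
  rw [Nat.card_congr e, Nat.card_sigma]
  have hterm : ∀ b : Fin d → F, Nat.card {a : selfAdjoint F // corank (border a.1 b H) = k} =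
      if ∃ c, H *ᵥ c = b then
        (if k = corank H then q - 1 else if k = corank H + 1 then 1 else 0)
      else (if k + 1 = corank H then q else 0) := by
    intro b
    split_ifs with hb h1 h2 h3
    · obtain ⟨c, rfl⟩ := hb
      have hs := dotProduct_mulVec_mem_selfAdjoint hH c
      subst h1
      have : ∀ a : selfAdjoint F, corank (border a.1 (H *ᵥ c) H) = corank H ↔ a ≠ ⟨_, hs⟩ := by
        intro a
        rw [corank_border_of_mem _ _ hH, Ne, Subtype.ext_iff]
        split_ifs <;> simp_all
      rw [Nat.card_congr (Equiv.subtypeEquivRight this), Nat.card_eq_fintype_card,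
        Fintype.card_subtype_compl, Fintype.card_subtype_eq, ← Nat.card_eq_fintype_card, hq]
    · obtain ⟨c, rfl⟩ := hb
      have hs := dotProduct_mulVec_mem_selfAdjoint hH c
      subst h2
      have : ∀ a : selfAdjoint F,
          corank (border a.1 (H *ᵥ c) H) = corank H + 1 ↔ a = ⟨_, hs⟩ := by
        intro a
        rw [corank_border_of_mem _ _ hH, Subtype.ext_iff]
        split_ifs <;> simp_all
      rw [Nat.card_congr (Equiv.subtypeEquivRight this), Nat.card_eq_fintype_card,
        Fintype.card_subtype_eq]
    · obtain ⟨c, rfl⟩ := hb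
      have : IsEmpty {a : selfAdjoint F // corank (border a.1 (H *ᵥ c) H) = k} :=
        ⟨fun a => by
          have := a.2
          rw [corank_border_of_mem _ _ hH] at this
          split_ifs at this <;> omega⟩
      exact Nat.card_of_isEmpty
    · rw [← hq]
      exact Nat.card_congr (Equiv.subtypeUnivEquiv fun a => by
        have := corank_border_of_notMem a.1 hH hb
        omega)
    · have : IsEmpty {a : selfAdjoint F // corank (border a.1 b H) = k} :=
        ⟨fun a => by
          have := corank_border_of_notMem a.1.1 hH hb
          have := a.2
          omega⟩
      exact Nat.card_of_isEmpty
  simp_rw [hterm]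
  rw [Finset.sum_ite, Finset.sum_const, Finset.sum_const, smul_eq_mul, smul_eq_mul, borderCount]
  have hr : (Finset.univ.filter fun b : Fin d → F => ∃ c, H *ᵥ c = b).card =
      q ^ (2 * (d - corank H)) := by
    rw [pow_mul, ← hF, ← card_range, Nat.card_eq_fintype_card, Fintype.card_subtype]
  have hr' : (Finset.univ.filter fun b : Fin d → F => ¬ ∃ c, H *ᵥ c = b).card =
      q ^ (2 * d) - q ^ (2 * (d - corank H)) := by
    rw [← hr, pow_mul, ← hF, Finset.filter_not,
      Finset.card_sdiff_of_subset (Finset.filter_subset _ _), Finset.card_univ, Fintype.card_pi,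
      Nat.card_eq_fintype_card]
    simp
  rw [hr, hr']

variable (F) in
/-- The number of Hermitian `d × d` matrices of corank `k`. -/
noncomputable def hermitianCount (d k : ℕ) : ℕ :=
  Nat.card {H : Matrix (Fin d) (Fin d) F // H.IsHermitian ∧ corank H = k}

lemma hermitianCount_succ {q : ℕ} (hq : Nat.card (selfAdjoint F) = q) (hF : Nat.card F = q ^ 2)
    (d k : ℕ) : hermitianCount F (d + 1) k =
      ∑ j ∈ Finset.range (d + 1), hermitianCount F d j * borderCount q d j k := by
  classical
  have := Fintype.ofFinite F
  let e : {H : Matrix (Fin (d + 1)) (Fin (d + 1)) F // H.IsHermitian ∧ corank H = k} ≃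
      Σ H : {H : Matrix (Fin d) (Fin d) F // H.IsHermitian},
        {p : (Fin d → F) × selfAdjoint F // corank (border p.2.1 p.1 H.1) = k} :=
    { toFun := fun M =>
        have h : border (M.1 0 0) (fun i => M.1 i.succ 0) (M.1.submatrix Fin.succ Fin.succ) =
          M.1 := by
          ext i j
          refine Fin.cases (Fin.cases ?_ (fun j => ?_) j) (fun i => Fin.cases ?_ (fun j => ?_) j) i
          · simp [border]
          · simpa [border] using M.2.1.apply 0 j.succ
          · simp [border]
          · simp [border]
        have h' := border_isHermitian.1 (h.symm ▸ M.2.1)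
        ⟨⟨M.1.submatrix Fin.succ Fin.succ, h'.2⟩, (fun i => M.1 i.succ 0, ⟨M.1 0 0, h'.1⟩),
          by rw [h]; exact M.2.2⟩
      invFun := fun p => ⟨border p.2.1.2.1 p.2.1.1 p.1.1,
        border_isHermitian.2 ⟨p.2.1.2.2, p.1.2⟩, p.2.2⟩
      left_inv := fun M => by
        ext i j
        refine Fin.cases (Fin.cases ?_ (fun j => ?_) j) (fun i => Fin.cases ?_ (fun j => ?_) j) i
        · simp [border]
        · simpa [border] using M.2.1.apply 0 j.succ
        · simp [border]
        · simp [border]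
      right_inv := fun p => rfl }
  rw [hermitianCount, Nat.card_congr e, Nat.card_sigma]
  simp_rw [fun H : {H : Matrix (Fin d) (Fin d) F // H.IsHermitian} => card_border hq hF H.2 k]
  rw [← Finset.sum_fiberwise_of_maps_to
    (g := fun H : {H : Matrix (Fin d) (Fin d) F // H.IsHermitian} => corank H.1)
    (t := Finset.range (d + 1)) fun H _ => Finset.mem_range.2 (Nat.lt_succ_of_le (corank_le H.1))]
  refine Finset.sum_congr rfl fun j _ => ?_
  rw [Finset.sum_congr rfl fun H hH => by rw [(Finset.mem_filter.1 hH).2], Finset.sum_const,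
    smul_eq_mul, hermitianCount,
    ← Nat.card_congr (Equiv.subtypeSubtypeEquivSubtypeInter _ _), Nat.card_eq_fintype_card,
    Fintype.card_subtype]

end HermitianCount

open Polynomial in
lemma exists_polynomial_borderCount (d j k : ℕ) (hj : j ≤ d) :
    ∃ P : ℕ[X], ∀ q, 1 ≤ q → borderCount q d j k = P.eval (q - 1) := by
  refine ⟨(X + 1) ^ (2 * (d - j)) * (if k = j then X else if k = j + 1 then 1 else 0) +
    (X + 1) ^ (2 * (d - j)) * (X * ∑ i ∈ Finset.range (2 * j), (X + 1) ^ i) *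
      (if k + 1 = j then X + 1 else 0), fun q hq => ?_⟩
  obtain ⟨v, rfl⟩ := Nat.exists_eq_add_of_le' hq
  have h : (v + 1) ^ (2 * d) - (v + 1) ^ (2 * (d - j)) =
      (v + 1) ^ (2 * (d - j)) * (v * ∑ i ∈ Finset.range (2 * j), (v + 1) ^ i) := by
    have hg := Commute.mul_geom_sum₂ (Commute.one_right ((v : ℤ) + 1)) (2 * j)
    have h2 : 2 * d = 2 * (d - j) + 2 * j := by omega
    rw [h2, pow_add, Nat.sub_eq_iff_eq_add (Nat.le_mul_of_pos_right _ (by positivity))]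
    zify
    simp only [one_pow, mul_one, add_sub_cancel_right] at hg
    rw [hg]; ring
  rw [borderCount, h]
  simp only [eval_add, eval_mul, eval_pow, eval_X, eval_one, eval_finsetSum, Nat.add_sub_cancel]
  split_ifs <;> simp

open Polynomial in
/-- Hermitian matrices of given corank are counted by a polynomial in `q - 1`. -/
lemma exists_polynomial_hermitianCount (d k : ℕ) :
    ∃ P : ℕ[X], ∀ (q : ℕ) (F : Type) [Field F] [Finite F] [StarRing F],
      Nat.card (selfAdjoint F) = q → Nat.card F = q ^ 2 →
      hermitianCount F d k = P.eval (q - 1) := by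
  induction d generalizing k with
  | zero =>
    refine ⟨if k = 0 then 1 else 0, fun q F _ _ _ _ _ => ?_⟩
    have h0 : ∀ H : Matrix (Fin 0) (Fin 0) F, corank H = 0 := fun H =>
      Nat.le_zero.1 (corank_le H)
    rw [hermitianCount]
    split_ifs with hk
    · subst hk
      rw [eval_one, Nat.card_eq_one_iff_unique]
      exact ⟨inferInstance, ⟨⟨0, isHermitian_zero, h0 _⟩⟩⟩
    · rw [eval_zero]
      have : IsEmpty {H : Matrix (Fin 0) (Fin 0) F // H.IsHermitian ∧ corank H = k} :=
        ⟨fun H => hk (H.2.2.symm.trans (h0 _))⟩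
      exact Nat.card_of_isEmpty
  | succ d ih =>
    choose P hP using ih
    have hB : ∀ j, ∃ B : ℕ[X], j ≤ d → ∀ q, 1 ≤ q → borderCount q d j k = B.eval (q - 1) := by
      intro j
      by_cases hj : j ≤ d
      · obtain ⟨B, hB⟩ := exists_polynomial_borderCount d j k hj
        exact ⟨B, fun _ => hB⟩
      · exact ⟨0, fun h => absurd h hj⟩
    choose B hB using hB
    refine ⟨∑ j ∈ Finset.range (d + 1), P j * B j, fun q F _ _ _ hq hF => ?_⟩
    rw [hermitianCount_succ hq hF, eval_finsetSum]
    refine Finset.sum_congr rfl fun j hj => ?_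
    rw [eval_mul, hP j q F hq hF, hB j (Nat.lt_succ_iff.1 (Finset.mem_range.1 hj)) q]
    rw [← hq]
    exact Nat.card_pos

section Duality

variable {F : Type} [Field F] [StarRing F]

omit [StarRing F] in
lemma exists_trace_mul_eq {ι ι' : Type} [Fintype ι] [Fintype ι'] [DecidableEq ι]
    [DecidableEq ι'] {N : Matrix ι ι' F} (hN : N ≠ 0) (a : F) :
    ∃ M : Matrix ι' ι F, (M * N).trace = a := by
  obtain ⟨i, j, hij⟩ : ∃ i j, N i j ≠ 0 := by
    by_contra! h
    exact hN (Matrix.ext h)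
  refine ⟨Matrix.single j i (a / N i j), ?_⟩
  rw [Matrix.trace_single_mul, smul_eq_mul, div_mul_cancel₀ _ hij]

variable {d : ℕ} {ι : Type} [Fintype ι] [DecidableEq ι]

lemma trace_conjTranspose_mul_eq {H M : Matrix (Fin d) (Fin d) F} (hH : H.IsHermitian) :
    (Mᴴ * H).trace = star (M * H).trace := by
  rw [← Matrix.trace_conjTranspose, Matrix.conjTranspose_mul, hH.eq, Matrix.trace_mul_comm]

/-- The character of the additive group of skew-Hermitian matrices attached to a matrix. -/
noncomputable def traceChar (ψ : AddChar F ℂ) (H : Matrix (Fin d) (Fin d) F) :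
    AddChar (skewAdjoint (Matrix (Fin d) (Fin d) F)) ℂ where
  toFun Y := ψ (Y.1 * H).trace
  map_zero_eq_one' := by simp
  map_add_eq_mul' X Y := by simp [add_mul, AddChar.map_add_eq_mul]

lemma eq_zero_of_traceChar_eq_one {ψ : AddChar F ℂ} {ε : F} (h2 : (2 : F) ≠ 0)
    (hε : star ε = -ε) (hψ : ψ ε ≠ 1) {H : Matrix (Fin d) (Fin d) F} (hH : H.IsHermitian)
    (h : ∀ Y, traceChar ψ H Y = 1) : H = 0 := by
  by_contra hne
  obtain ⟨M, hM⟩ := exists_trace_mul_eq hne (ε / 2)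
  apply hψ
  have hs : M - Mᴴ ∈ skewAdjoint (Matrix (Fin d) (Fin d) F) := by
    simp [skewAdjoint.mem_iff, star_eq_conjTranspose]
  rw [← h ⟨_, hs⟩]
  change _ = ψ ((M - Mᴴ) * H).trace
  rw [sub_mul, Matrix.trace_sub, trace_conjTranspose_mul_eq hH, hM, star_div₀, hε, star_ofNat]
  congr 1
  field_simp
  ring

/-- The trace form identifies Hermitian matrices with characters of skew-Hermitian matrices. -/
lemma traceChar_bijective [Finite F] {ψ : AddChar F ℂ} {ε : F} (h2 : (2 : F) ≠ 0)
    (hε : star ε = -ε) (hψ : ψ ε ≠ 1) :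
    Function.Bijective
      fun H : {H : Matrix (Fin d) (Fin d) F // H.IsHermitian} => traceChar ψ H.1 := by
  classical
  have := Fintype.ofFinite F
  have hε0 : ε ≠ 0 := by rintro rfl; simp at hψ
  rw [Fintype.bijective_iff_injective_and_card]
  constructor
  · intro H H' h
    apply Subtype.ext
    rw [← sub_eq_zero]
    refine eq_zero_of_traceChar_eq_one h2 hε hψ (H.2.sub H'.2) fun Y => ?_
    have hY : ψ (Y.1 * H.1).trace = ψ (Y.1 * H'.1).trace := DFunLike.congr_fun h Y
    change ψ (Y.1 * (H.1 - H'.1)).trace = 1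
    rw [mul_sub, Matrix.trace_sub, AddChar.map_sub_eq_div, hY, div_self]
    exact (ψ.val_isUnit _).ne_zero
  · rw [AddChar.card_eq]
    refine Fintype.card_congr
      { toFun := fun H => ⟨ε • H.1, ?_⟩
        invFun := fun Y => ⟨ε⁻¹ • Y.1, ?_⟩
        left_inv := fun H => by simp [smul_smul, hε0]
        right_inv := fun Y => by simp [smul_smul, hε0] }
    · rw [skewAdjoint.mem_iff, star_smul, hε, star_eq_conjTranspose, H.2.eq, neg_smul]
    · have hY : Y.1ᴴ = -Y.1 := Y.2
      rw [Matrix.IsHermitian, conjTranspose_smul, star_inv₀, hε, hY, smul_neg, inv_neg, neg_smul,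
        neg_neg]

/-- The alternating cocycle on `Matrix (Fin d) ι F` attached to a Hermitian form. -/
noncomputable def skewCocycle {K : Matrix ι ι F} (hK : K.IsHermitian) :
    Matrix (Fin d) ι F →+ Matrix (Fin d) ι F →+ skewAdjoint (Matrix (Fin d) (Fin d) F) :=
  AddMonoidHom.mk' (fun X => AddMonoidHom.mk'
    (fun Y => ⟨(2 : F)⁻¹ • (Y * K * Xᴴ - X * K * Yᴴ), by
      rw [skewAdjoint.mem_iff, star_eq_conjTranspose, conjTranspose_smul, star_inv₀, star_ofNat,
        ← smul_neg, neg_sub, conjTranspose_sub]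
      simp only [conjTranspose_mul, conjTranspose_conjTranspose, hK.eq, Matrix.mul_assoc]⟩)
    fun Y Y' => Subtype.ext (by
      simp only [AddSubgroup.coe_add, ← smul_add, conjTranspose_add, Matrix.add_mul,
        Matrix.mul_add]
      congr 1; abel))
    fun X X' => AddMonoidHom.ext fun Y => Subtype.ext (by
      simp only [AddMonoidHom.mk'_apply, AddMonoidHom.add_apply, AddSubgroup.coe_add, ← smul_add,
        conjTranspose_add, Matrix.add_mul, Matrix.mul_add]
      congr 1; abel)

omit [DecidableEq ι] in
lemma skewCocycle_apply {K : Matrix ι ι F} (hK : K.IsHermitian) (X Y : Matrix (Fin d) ι F) :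
    (skewCocycle hK X Y).1 = (2 : F)⁻¹ • (Y * K * Xᴴ - X * K * Yᴴ) := rfl

lemma traceChar_skewCocycle_eq_one_iff {K : Matrix ι ι F} (hK : K.IsHermitian) (hKu : IsUnit K)
    {ψ : AddChar F ℂ} {ε : F} (h2 : (2 : F) ≠ 0) (hε : star ε = -ε) (hψ : ψ ε ≠ 1)
    {H : Matrix (Fin d) (Fin d) F} (hH : H.IsHermitian) (X : Matrix (Fin d) ι F) :
    (∀ Y, traceChar ψ H (skewCocycle hK X Y) = 1) ↔ H * X = 0 := by
  have key : ∀ Y, traceChar ψ H (skewCocycle hK X Y) =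
      ψ ((2 : F)⁻¹ * ((Y * (K * (Xᴴ * H))).trace - star (Y * (K * (Xᴴ * H))).trace)) := by
    intro Y
    change ψ ((2 : F)⁻¹ • (Y * K * Xᴴ - X * K * Yᴴ) * H).trace = _
    have hM : X * K * Yᴴ = (Y * K * Xᴴ)ᴴ := by
      simp only [conjTranspose_mul, conjTranspose_conjTranspose, hK.eq, Matrix.mul_assoc]
    rw [hM, smul_mul_assoc, Matrix.trace_smul, Matrix.sub_mul, Matrix.trace_sub,
      trace_conjTranspose_mul_eq hH, smul_eq_mul]
    simp only [Matrix.mul_assoc]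
  have hXH : Xᴴ * H = (H * X)ᴴ := by rw [conjTranspose_mul, hH.eq]
  simp_rw [key]
  constructor
  · intro h
    by_contra hne
    have hN : K * (Xᴴ * H) ≠ 0 := by
      intro h0
      apply hne
      have h1 : Xᴴ * H = 0 := by
        obtain ⟨u, rfl⟩ := hKu
        have := congrArg (fun M => (↑u⁻¹ : Matrix ι ι F) * M) h0
        simpa [← Matrix.mul_assoc] using this
      rwa [hXH, conjTranspose_eq_zero] at h1
    obtain ⟨Y, hY⟩ := exists_trace_mul_eq hN ε
    have := h Y
    rw [hY, hε] at this
    apply hψ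
    rw [← this]
    congr 1
    field_simp
    ring
  · intro h Y
    simp [hXH, h]

omit [StarRing F] [DecidableEq ι] in
lemma card_mul_eq_zero (H : Matrix (Fin d) (Fin d) F) :
    Nat.card {X : Matrix (Fin d) ι F // H * X = 0} =
      Nat.card F ^ (corank H * Fintype.card ι) := by
  let e : {X : Matrix (Fin d) ι F // H * X = 0} ≃ (ι → {y : Fin d → F // H *ᵥ y = 0}) :=
    { toFun := fun X j => ⟨fun i => X.1 i j, funext fun i => congrFun (congrFun X.2 i) j⟩
      invFun := fun f => ⟨Matrix.of fun i j => (f j).1 i,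
        Matrix.ext fun i j => congrFun (f j).2 i⟩
      left_inv := fun _ => rfl
      right_inv := fun _ => rfl }
  rw [Nat.card_congr e, Nat.card_fun, card_ker, pow_mul,
    Nat.card_eq_fintype_card (α := ι)]

/-- Irreducible characters of a group whose centre is the group of skew-Hermitian matrices. -/
theorem card_irreducible_characters_skewCocycle [Finite F] {G : Type} [Group G] [Finite G]
    {K : Matrix ι ι F} (hK : K.IsHermitian) (hKu : IsUnit K) {ε : F} (h2 : (2 : F) ≠ 0)
    (hε : star ε = -ε) (hε0 : ε ≠ 0)
    (E : HeisenbergCoords G (Matrix (Fin d) ι F) (skewAdjoint (Matrix (Fin d) (Fin d) F)))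
    (hE : E.c = skewCocycle hK) (D : ℕ) :
    Nat.card {χ : G → ℂ | (∃ V : FDRep ℂ G, CategoryTheory.Simple V ∧ FDRep.character V = χ) ∧
        χ 1 = D} =
      ∑ k ∈ Finset.range (d + 1),
        if D ^ 2 * Nat.card F ^ (k * Fintype.card ι) = Nat.card F ^ (d * Fintype.card ι) then
          hermitianCount F d k * Nat.card F ^ (k * Fintype.card ι) else 0 := by
  classical
  obtain ⟨ψ, hψ⟩ := (AddChar.exists_apply_ne_zero (a := ε)).2 hε0
  have := Fintype.ofFinite F
  have hrad : ∀ H : {H : Matrix (Fin d) (Fin d) F // H.IsHermitian},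
      Nat.card (E.rad (traceChar ψ H.1)) = Nat.card F ^ (corank H.1 * Fintype.card ι) := by
    intro H
    rw [← card_mul_eq_zero]
    refine Nat.card_congr (Equiv.subtypeEquivRight fun X => ?_)
    rw [E.mem_rad, hE]
    exact traceChar_skewCocycle_eq_one_iff hK hKu h2 hε hψ H.2 X
  have hW : Nat.card (Matrix (Fin d) ι F) = Nat.card F ^ (d * Fintype.card ι) := by
    rw [Nat.card_congr (show Matrix (Fin d) ι F ≃ (Fin d × ι → F) from (Equiv.curry _ _ _).symm),
      Nat.card_fun, Nat.card_prod, Nat.card_fin, Nat.card_eq_fintype_card (α := ι)]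
  rw [E.card_irreducible_characters, Nat.card_sigma, hW]
  let g : AddChar (skewAdjoint (Matrix (Fin d) (Fin d) F)) ℂ → ℕ := fun l =>
    if D ^ 2 * Nat.card (E.rad l) = Nat.card F ^ (d * Fintype.card ι) then
      Nat.card (E.rad l) else 0
  have hg : (∑ l : {l : AddChar (skewAdjoint (Matrix (Fin d) (Fin d) F)) ℂ //
      D ^ 2 * Nat.card (E.rad l) = Nat.card F ^ (d * Fintype.card ι)}, Nat.card (E.rad l.1)) =
      ∑ l, g l := by
    rw [← Finset.sum_filter]
    exact (Finset.sum_subtype _ (fun l => Finset.mem_filter_univ l)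
      fun l => Nat.card (E.rad l)).symm
  rw [hg, ← (Equiv.ofBijective _ (traceChar_bijective (d := d) h2 hε hψ)).sum_comp]
  simp only [Equiv.ofBijective_apply, g, hrad]
  rw [← Finset.sum_fiberwise_of_maps_to
    (g := fun H : {H : Matrix (Fin d) (Fin d) F // H.IsHermitian} => corank H.1)
    (t := Finset.range (d + 1)) fun H _ => Finset.mem_range.2 (Nat.lt_succ_of_le (corank_le H.1))]
  refine Finset.sum_congr rfl fun j _ => ?_
  have hc : hermitianCount F d j = ({H : {H : Matrix (Fin d) (Fin d) F // H.IsHermitian} |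
      corank H.1 = j} : Finset _).card := by
    rw [hermitianCount, ← Nat.card_congr (Equiv.subtypeSubtypeEquivSubtypeInter _ _),
      Nat.card_eq_fintype_card, Fintype.card_subtype]
  rw [Finset.sum_congr rfl fun H hH => by rw [(Finset.mem_filter.1 hH).2], Finset.sum_const,
    smul_eq_mul, hc]
  split_ifs <;> simp

end Duality

section Frobenius

variable {F : Type} [Field F] [Finite F]

/-- The involution `x ↦ x ^ q` of a field with `q ^ 2` elements. -/
@[reducible]
def starRingOfCard {p k q : ℕ} (hp : p.Prime) (hq : q = p ^ k) (hF : Nat.card F = q ^ 2) :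
    StarRing F where
  star x := x ^ q
  star_involutive x := by
    have := Fintype.ofFinite F
    change (x ^ q) ^ q = x
    rw [← pow_mul, ← sq, ← hF, Nat.card_eq_fintype_card, FiniteField.pow_card]
  star_mul x y := by rw [mul_pow, mul_comm]
  star_add x y := by
    have := Fact.mk hp
    have hc : CharP F p := by
      have := Fintype.ofFinite F
      apply charP_of_card_eq_prime_pow (f := k * 2)
      rw [← Nat.card_eq_fintype_card, hF, hq, pow_mul]
    rw [hq, add_pow_char_pow]

variable [StarRing F]

omit [Finite F] in
lemma exists_star_eq_neg {x : F} (hx : star x ≠ x) : ∃ ε : F, star ε = -ε ∧ ε ≠ 0 :=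
  ⟨x - star x, by simp, fun h => hx (sub_eq_zero.1 h).symm⟩

omit [Finite F] in
lemma card_selfAdjoint {q : ℕ} (hF : Nat.card F = q ^ 2) (h2 : (2 : F) ≠ 0) {ε : F}
    (hε : star ε = -ε) (hε0 : ε ≠ 0) : Nat.card (selfAdjoint F) = q := by
  let e : F ≃ selfAdjoint F × selfAdjoint F :=
    { toFun := fun x => (⟨x + star x, by simp [selfAdjoint.mem_iff, add_comm]⟩,
        ⟨(x - star x) / ε, by
          rw [selfAdjoint.mem_iff, star_div₀, hε, star_sub, star_star, div_neg, ← neg_div,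
            neg_sub]⟩)
      invFun := fun y => (y.1 + ε * y.2) / 2
      left_inv := fun x => by
        simp only
        field_simp
        ring
      right_inv := fun y => by
        have h1 : star (y.1 : F) = y.1 := y.1.2
        have h3 : star (y.2 : F) = y.2 := y.2.2
        ext
        · simp only [star_div₀, star_add, star_mul', h1, h3, hε, star_ofNat]
          field_simp
          ring
        · simp only [star_div₀, star_add, star_mul', h1, h3, hε, star_ofNat]
          field_simp
          ring }
  rw [Nat.card_congr e, Nat.card_prod, ← sq] at hF
  exact Nat.pow_left_injective two_ne_zero hF

end Frobenius

lemma exists_pow_ne_self {F : Type} [Field F] [Fintype F] {q : ℕ} (hq : 1 < q)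
    (hF : Fintype.card F = q ^ 2) : ∃ x : F, x ^ q ≠ x := by
  by_contra! h
  refine FiniteField.X_pow_card_sub_X_ne_zero F hq
    (Polynomial.eq_zero_of_natDegree_lt_card_of_eval_eq_zero' _ Finset.univ
      (fun x _ => by simp [h x]) ?_)
  rw [FiniteField.X_pow_card_sub_X_natDegree_eq F hq, Finset.card_univ, hF]
  exact lt_self_pow₀ hq one_lt_two

section Antidiagonal

variable (F : Type) [Field F] (m : ℕ)

lemma antidiagMat_apply (i j : Fin m) :
    antidiagMat F m i j = if i = Fin.rev j then 1 else 0 := by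
  simp only [antidiagMat, Matrix.of_apply, Fin.ext_iff, Fin.val_rev]
  congr 1
  apply propext
  omega

lemma antidiagMat_mul_self : antidiagMat F m * antidiagMat F m = 1 := by
  ext i j
  simp [Matrix.mul_apply, antidiagMat_apply, Matrix.one_apply]

lemma conjTranspose_antidiagMat [StarRing F] : (antidiagMat F m)ᴴ = antidiagMat F m := by
  ext i j
  simp only [conjTranspose_apply, antidiagMat_apply, apply_ite star, star_one, star_zero]
  congr 1
  apply propext
  rw [Fin.rev_eq_iff.symm, eq_comm]

/-- The antidiagonal Hermitian form on the middle block. -/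
def middleForm : Matrix (Fin m ⊕ Fin m) (Fin m ⊕ Fin m) F :=
  fromBlocks 0 (antidiagMat F m) (antidiagMat F m) 0

lemma middleForm_isHermitian [StarRing F] : (middleForm F m).IsHermitian := by
  simp [middleForm, Matrix.IsHermitian, fromBlocks_conjTranspose, conjTranspose_antidiagMat]

lemma middleForm_isUnit : IsUnit (middleForm F m) :=
  IsUnit.of_mul_eq_one (middleForm F m) (by
    simp [middleForm, fromBlocks_multiply, antidiagMat_mul_self])

end Antidiagonal

section Radical

variable {F : Type} [Field F] {d m : ℕ}

/-- Block unitriangular matrices with identity middle block. -/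
def blockMat (X₁ X₂ : Matrix (Fin d) (Fin m) F) (Y : Matrix (Fin d) (Fin d) F)
    (Z₁ Z₂ : Matrix (Fin m) (Fin d) F) :
    Matrix ((Fin d ⊕ Fin m) ⊕ (Fin m ⊕ Fin d)) ((Fin d ⊕ Fin m) ⊕ (Fin m ⊕ Fin d)) F :=
  fromBlocks (fromBlocks 1 X₁ 0 1) (fromBlocks X₂ Y 0 Z₁) 0 (fromBlocks 1 Z₂ 0 1)

lemma blockMat_mul (X₁ X₂ X₁' X₂' : Matrix (Fin d) (Fin m) F) (Y Y' : Matrix (Fin d) (Fin d) F)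
    (Z₁ Z₂ Z₁' Z₂' : Matrix (Fin m) (Fin d) F) :
    blockMat X₁ X₂ Y Z₁ Z₂ * blockMat X₁' X₂' Y' Z₁' Z₂' =
      blockMat (X₁ + X₁') (X₂ + X₂') (Y + Y' + (X₁ * Z₁' + X₂ * Z₂')) (Z₁ + Z₁') (Z₂ + Z₂') := by
  simp only [blockMat, fromBlocks_multiply, fromBlocks_add, Matrix.mul_zero, Matrix.zero_mul,
    Matrix.one_mul, Matrix.mul_one, add_zero, zero_add]
  congr 2 <;> abel

lemma blockMat_injective {X₁ X₂ X₁' X₂' : Matrix (Fin d) (Fin m) F}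
    {Y Y' : Matrix (Fin d) (Fin d) F} {Z₁ Z₂ Z₁' Z₂' : Matrix (Fin m) (Fin d) F}
    (h : blockMat X₁ X₂ Y Z₁ Z₂ = blockMat X₁' X₂' Y' Z₁' Z₂') : X₁ = X₁' ∧ X₂ = X₂' ∧ Y = Y' := by
  simp only [blockMat, fromBlocks_inj] at h
  tauto

variable [StarRing F]

lemma blockMat_unitary_iff {n : ℕ} (X₁ X₂ : Matrix (Fin d) (Fin (n - d)) F)
    (Y : Matrix (Fin d) (Fin d) F) (Z₁ Z₂ : Matrix (Fin (n - d)) (Fin d) F) :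
    (blockMat X₁ X₂ Y Z₁ Z₂)ᴴ * J2n F n d * blockMat X₁ X₂ Y Z₁ Z₂ = J2n F n d ↔
      antidiagMat F (n - d) * Z₂ + X₁ᴴ * antidiagMat F d = 0 ∧
      antidiagMat F (n - d) * Z₁ + X₂ᴴ * antidiagMat F d = 0 ∧
      antidiagMat F d * Y + Z₂ᴴ * antidiagMat F (n - d) * Z₁ +
        (Z₁ᴴ * antidiagMat F (n - d) * Z₂ + Yᴴ * antidiagMat F d) = 0 := by
  have hi := conjTranspose_antidiagMat F (n - d)
  have hj := conjTranspose_antidiagMat F d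
  simp only [blockMat, J2n, fromBlocks_conjTranspose, fromBlocks_multiply, fromBlocks_add,
    Matrix.mul_zero, Matrix.zero_mul, Matrix.one_mul, Matrix.mul_one, add_zero, zero_add,
    conjTranspose_zero, conjTranspose_one, fromBlocks_inj, ← fromBlocks_zero, true_and]
  generalize antidiagMat F (n - d) = i at *
  generalize antidiagMat F d = j at *
  have h (X : Matrix (Fin d) (Fin (n - d)) F) (Z : Matrix (Fin (n - d)) (Fin d) F) :
      j * X + Zᴴ * i = 0 ↔ i * Z + Xᴴ * j = 0 := by
    rw [← conjTranspose_eq_zero]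
    simp [conjTranspose_mul, hi, hj, add_comm]
  rw [h, h]
  tauto

/-- The block matrix whose first block row is `1, X, s * antidiagMat F d` and whose last block
column is forced by unitarity. -/
def radicalMat (X : Matrix (Fin d) (Fin m ⊕ Fin m) F) (s : Matrix (Fin d) (Fin d) F) :
    Matrix ((Fin d ⊕ Fin m) ⊕ (Fin m ⊕ Fin d)) ((Fin d ⊕ Fin m) ⊕ (Fin m ⊕ Fin d)) F :=
  blockMat X.toCols₁ X.toCols₂ (s * antidiagMat F d)
    (-(antidiagMat F m * X.toCols₂ᴴ * antidiagMat F d))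
    (-(antidiagMat F m * X.toCols₁ᴴ * antidiagMat F d))

lemma mul_middleForm_mul_conjTranspose (X X' : Matrix (Fin d) (Fin m ⊕ Fin m) F) :
    X * middleForm F m * X'ᴴ = X.toCols₁ * antidiagMat F m * X'.toCols₂ᴴ +
      X.toCols₂ * antidiagMat F m * X'.toCols₁ᴴ := by
  conv_lhs => rw [← fromCols_toCols X, ← fromCols_toCols X']
  rw [middleForm, fromCols_mul_fromBlocks, conjTranspose_fromCols_eq_fromRows_conjTranspose,
    fromCols_mul_fromRows]
  simp [add_comm]

lemma radicalMat_mul (X X' : Matrix (Fin d) (Fin m ⊕ Fin m) F) (s s' : Matrix (Fin d) (Fin d) F) :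
    radicalMat X s * radicalMat X' s' =
      radicalMat (X + X') (s + s' - X * middleForm F m * X'ᴴ) := by
  rw [mul_middleForm_mul_conjTranspose, radicalMat, radicalMat, blockMat_mul, radicalMat]
  have h1 : (X + X').toCols₁ = X.toCols₁ + X'.toCols₁ := rfl
  have h2 : (X + X').toCols₂ = X.toCols₂ + X'.toCols₂ := rfl
  rw [h1, h2]
  congr 1
  · simp only [Matrix.mul_neg, Matrix.add_mul, Matrix.sub_mul, Matrix.mul_assoc]
    abel
  · simp only [conjTranspose_add, Matrix.mul_add, Matrix.add_mul, neg_add]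
  · simp only [conjTranspose_add, Matrix.mul_add, Matrix.add_mul, neg_add]

lemma radicalMat_zero : radicalMat (0 : Matrix (Fin d) (Fin m ⊕ Fin m) F) 0 = 1 := by
  have h1 : (0 : Matrix (Fin d) (Fin m ⊕ Fin m) F).toCols₁ = 0 := rfl
  have h2 : (0 : Matrix (Fin d) (Fin m ⊕ Fin m) F).toCols₂ = 0 := rfl
  simp [radicalMat, blockMat, h1, h2]

lemma radicalMat_injective {X X' : Matrix (Fin d) (Fin m ⊕ Fin m) F}
    {s s' : Matrix (Fin d) (Fin d) F} (h : radicalMat X s = radicalMat X' s') :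
    X = X' ∧ s = s' := by
  obtain ⟨h1, h2, h3⟩ := blockMat_injective h
  refine ⟨by rw [← fromCols_toCols X, ← fromCols_toCols X', h1, h2], ?_⟩
  have := congrArg (· * antidiagMat F d) h3
  simpa [Matrix.mul_assoc, antidiagMat_mul_self] using this

lemma mem_RuU_iff {n q : ℕ} (hstar : ∀ x : F, star x = x ^ q) (g : Matrix (κ n d) (κ n d) F) :
    g ∈ RuU q F n d ↔ ∃ (X : Matrix (Fin d) (Fin (n - d) ⊕ Fin (n - d)) F)
      (s : Matrix (Fin d) (Fin d) F), s + sᴴ + X * middleForm F (n - d) * Xᴴ = 0 ∧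
        g = radicalMat X s := by
  have hg : (g.map fun x => x ^ q)ᵀ = gᴴ := by
    ext i j
    simp [hstar]
  have hi := antidiagMat_mul_self F (n - d)
  have hj := antidiagMat_mul_self F d
  have hi' := conjTranspose_antidiagMat F (n - d)
  have hj' := conjTranspose_antidiagMat F d
  have hcond (X : Matrix (Fin d) (Fin (n - d) ⊕ Fin (n - d)) F) (s : Matrix (Fin d) (Fin d) F) :
      (radicalMat X s)ᴴ * J2n F n d * radicalMat X s = J2n F n d ↔
        s + sᴴ + X * middleForm F (n - d) * Xᴴ = 0 := by
    rw [mul_middleForm_mul_conjTranspose, radicalMat, blockMat_unitary_iff]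
    generalize antidiagMat F (n - d) = i at *
    generalize antidiagMat F d = j at *
    have hi2 (M : Matrix (Fin (n - d)) (Fin d) F) : i * (i * M) = M := by
      rw [← Matrix.mul_assoc, hi, Matrix.one_mul]
    have hj2 (M : Matrix (Fin d) (Fin d) F) : j * (j * M) = M := by
      rw [← Matrix.mul_assoc, hj, Matrix.one_mul]
    simp only [conjTranspose_neg, conjTranspose_mul, conjTranspose_conjTranspose, hi', hj',
      Matrix.mul_neg, Matrix.neg_mul, neg_neg, Matrix.mul_assoc, hi2, neg_add_cancel, true_and]
    have key : j * (s + sᴴ + (X.toCols₁ * (i * X.toCols₂ᴴ) + X.toCols₂ * (i * X.toCols₁ᴴ))) * j =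
        j * (s * j) + j * (X.toCols₁ * (i * (X.toCols₂ᴴ * j))) +
          (j * (X.toCols₂ * (i * (X.toCols₁ᴴ * j))) + j * (sᴴ * j)) := by
      simp only [Matrix.mul_add, Matrix.add_mul, Matrix.mul_assoc]
      abel
    rw [← key]
    refine ⟨fun h => ?_, fun h => by rw [h, Matrix.mul_zero, Matrix.zero_mul]⟩
    have := congrArg (fun M => j * (M * j)) h
    simpa only [Matrix.mul_assoc, hj, hj2, Matrix.mul_one, Matrix.mul_zero, Matrix.zero_mul]
      using this
  have hZ {X : Matrix (Fin d) (Fin (n - d)) F} {Z : Matrix (Fin (n - d)) (Fin d) F}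
      (h : antidiagMat F (n - d) * Z + Xᴴ * antidiagMat F d = 0) :
      Z = -(antidiagMat F (n - d) * Xᴴ * antidiagMat F d) := by
    rw [Matrix.mul_assoc, ← Matrix.mul_neg, ← eq_neg_of_add_eq_zero_left h, ← Matrix.mul_assoc, hi,
      Matrix.one_mul]
  rw [RuU, Set.mem_ofPred_eq, hg]
  constructor
  · rintro ⟨hu, h0, h1⟩
    obtain ⟨X₁, X₂, Y, Z₁, Z₂, rfl⟩ : ∃ (X₁ X₂ : Matrix (Fin d) (Fin (n - d)) F)
        (Y : Matrix (Fin d) (Fin d) F) (Z₁ Z₂ : Matrix (Fin (n - d)) (Fin d) F),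
        g = blockMat X₁ X₂ Y Z₁ Z₂ := by
      refine ⟨of fun i j => g (.inl (.inl i)) (.inl (.inr j)),
        of fun i j => g (.inl (.inl i)) (.inr (.inl j)),
        of fun i j => g (.inl (.inl i)) (.inr (.inr j)),
        of fun i j => g (.inl (.inr i)) (.inr (.inr j)),
        of fun i j => g (.inr (.inl i)) (.inr (.inr j)), Matrix.ext ?_⟩
      rintro ((i | i) | (i | i)) ((j | j) | (j | j)) <;>
        first
        | rfl
        | (refine h0 _ _ ?_; simp [lvl]; done)
        | (refine (h1 _ _ ?_).trans ?_ <;> simp [lvl, blockMat, Matrix.one_apply])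
    have hgr : blockMat X₁ X₂ Y Z₁ Z₂ = radicalMat (fromCols X₁ X₂) (Y * antidiagMat F d) := by
      rw [blockMat_unitary_iff] at hu
      obtain ⟨hZ₂, hZ₁, -⟩ := hu
      rw [radicalMat, toCols₁_fromCols, toCols₂_fromCols, Matrix.mul_assoc, hj, Matrix.mul_one,
        ← hZ hZ₁, ← hZ hZ₂]
    refine ⟨fromCols X₁ X₂, Y * antidiagMat F d, ?_, hgr⟩
    rwa [← hcond, ← hgr]
  · rintro ⟨X, s, hs, rfl⟩
    refine ⟨(hcond X s).2 hs, ?_, ?_⟩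
    · rintro ((i | i) | (i | i)) ((j | j) | (j | j)) h <;>
        simp [radicalMat, blockMat, lvl] at h ⊢
    · rintro ((i | i) | (i | i)) ((j | j) | (j | j)) h <;>
        simp [radicalMat, blockMat, lvl, Matrix.one_apply] at h ⊢

/-- The element of the unipotent radical with given coordinates. -/
noncomputable def coordMat (a : Matrix (Fin d) (Fin m ⊕ Fin m) F ×
      skewAdjoint (Matrix (Fin d) (Fin d) F)) :
    Matrix ((Fin d ⊕ Fin m) ⊕ (Fin m ⊕ Fin d)) ((Fin d ⊕ Fin m) ⊕ (Fin m ⊕ Fin d)) F :=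
  radicalMat a.1 (a.2.1 - (2 : F)⁻¹ • (a.1 * middleForm F m * a.1ᴴ))

lemma coordMat_zero : coordMat (F := F) (d := d) (m := m) 0 = 1 := by
  simp [coordMat, radicalMat_zero]

lemma coordMat_injective : Function.Injective (coordMat (F := F) (d := d) (m := m)) := by
  rintro ⟨X, t⟩ ⟨X', t'⟩ h
  obtain ⟨h1, h2⟩ := radicalMat_injective h
  simp only at h1
  subst h1
  exact Prod.ext rfl (Subtype.ext (sub_left_injective h2))

lemma coordMat_mul (h2 : (2 : F) ≠ 0) (a b : Matrix (Fin d) (Fin m ⊕ Fin m) F ×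
      skewAdjoint (Matrix (Fin d) (Fin d) F)) :
    coordMat a * coordMat b =
      coordMat (a.1 + b.1, a.2 + b.2 + skewCocycle (middleForm_isHermitian F m) a.1 b.1) := by
  rw [coordMat, coordMat, radicalMat_mul, coordMat]
  congr 1
  simp only [AddSubgroup.coe_add, skewCocycle_apply, conjTranspose_add, Matrix.add_mul,
    Matrix.mul_add, smul_sub, smul_add]
  have h (M : Matrix (Fin d) (Fin d) F) : M = (2 : F)⁻¹ • M + (2 : F)⁻¹ • M := by
    rw [← add_smul, ← two_mul, mul_inv_cancel₀ h2, one_smul]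
  conv_lhs => rw [h (a.1 * middleForm F m * b.1ᴴ)]
  abel

/-- The invertible matrix underlying `coordMat`. -/
noncomputable def coordUnit (h2 : (2 : F) ≠ 0) (a : Matrix (Fin d) (Fin m ⊕ Fin m) F ×
      skewAdjoint (Matrix (Fin d) (Fin d) F)) :
    (Matrix ((Fin d ⊕ Fin m) ⊕ (Fin m ⊕ Fin d)) ((Fin d ⊕ Fin m) ⊕ (Fin m ⊕ Fin d)) F)ˣ where
  val := coordMat a
  inv := coordMat (-a)
  val_inv := by
    rw [coordMat_mul h2, ← coordMat_zero]
    congr 1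
    refine Prod.ext (by simp) (Subtype.ext ?_)
    simp [skewCocycle_apply]
  inv_val := by
    rw [coordMat_mul h2, ← coordMat_zero]
    congr 1
    refine Prod.ext (by simp) (Subtype.ext ?_)
    simp [skewCocycle_apply]

lemma half_add_conjTranspose_half (h2 : (2 : F) ≠ 0) (X : Matrix (Fin d) (Fin m ⊕ Fin m) F) :
    (2 : F)⁻¹ • (X * middleForm F m * Xᴴ) + ((2 : F)⁻¹ • (X * middleForm F m * Xᴴ))ᴴ =
      X * middleForm F m * Xᴴ := by
  rw [conjTranspose_smul, star_inv₀, star_ofNat, conjTranspose_mul, conjTranspose_mul,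
    conjTranspose_conjTranspose, (middleForm_isHermitian F m).eq, ← Matrix.mul_assoc, ← add_smul,
    ← two_mul, mul_inv_cancel₀ h2, one_smul]

lemma coordMat_mem_RuU {n q : ℕ} (hstar : ∀ x : F, star x = x ^ q) (h2 : (2 : F) ≠ 0)
    (a : Matrix (Fin d) (Fin (n - d) ⊕ Fin (n - d)) F ×
      skewAdjoint (Matrix (Fin d) (Fin d) F)) :
    coordMat a ∈ RuU q F n d := by
  refine (mem_RuU_iff hstar _).2 ⟨_, _, ?_, rfl⟩
  have ha : a.2.1ᴴ = -a.2.1 := a.2.2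
  have h := half_add_conjTranspose_half h2 a.1
  rw [conjTranspose_sub, ha, ← sub_eq_zero.2 h.symm]
  abel

lemma exists_coordMat_eq {n q : ℕ} (hstar : ∀ x : F, star x = x ^ q) (h2 : (2 : F) ≠ 0)
    {g : Matrix (κ n d) (κ n d) F} (hg : g ∈ RuU q F n d) : ∃ a, coordMat a = g := by
  obtain ⟨X, s, hs, rfl⟩ := (mem_RuU_iff hstar _).1 hg
  have h := half_add_conjTranspose_half h2 X
  refine ⟨(X, ⟨s + (2 : F)⁻¹ • (X * middleForm F (n - d) * Xᴴ), ?_⟩), by simp [coordMat]⟩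
  rw [skewAdjoint.mem_iff, star_eq_conjTranspose, conjTranspose_add, ← add_eq_zero_iff_eq_neg,
    ← hs]
  nth_rw 3 [← h]
  abel

/-- Coordinates on the unipotent radical. -/
noncomputable def coordEquiv {n q : ℕ} (hstar : ∀ x : F, star x = x ^ q) (h2 : (2 : F) ≠ 0)
    (G : Subgroup (Matrix (κ n d) (κ n d) F)ˣ)
    (hG : ∀ u : (Matrix (κ n d) (κ n d) F)ˣ,
      u ∈ G ↔ (u : Matrix (κ n d) (κ n d) F) ∈ RuU q F n d) :
    Matrix (Fin d) (Fin (n - d) ⊕ Fin (n - d)) F × skewAdjoint (Matrix (Fin d) (Fin d) F) ≃ G :=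
  Equiv.ofBijective (fun a => ⟨coordUnit h2 a, (hG _).2 (coordMat_mem_RuU hstar h2 a)⟩)
    ⟨fun a b h => coordMat_injective (congrArg (fun u : G => u.1.1) h), fun g => by
      obtain ⟨a, ha⟩ := exists_coordMat_eq hstar h2 ((hG _).1 g.2)
      exact ⟨a, Subtype.ext (Units.ext ha)⟩⟩

/-- The unipotent radical in Heisenberg coordinates. -/
noncomputable def radicalCoords {n q : ℕ} (hstar : ∀ x : F, star x = x ^ q) (h2 : (2 : F) ≠ 0)
    (G : Subgroup (Matrix (κ n d) (κ n d) F)ˣ)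
    (hG : ∀ u : (Matrix (κ n d) (κ n d) F)ˣ,
      u ∈ G ↔ (u : Matrix (κ n d) (κ n d) F) ∈ RuU q F n d) :
    HeisenbergCoords G (Matrix (Fin d) (Fin (n - d) ⊕ Fin (n - d)) F)
      (skewAdjoint (Matrix (Fin d) (Fin d) F)) where
  equiv := (coordEquiv hstar h2 G hG).symm
  c := skewCocycle (middleForm_isHermitian F (n - d))
  c_swap X Y := Subtype.ext (by
    rw [NegMemClass.coe_neg, skewCocycle_apply, skewCocycle_apply, ← smul_neg, neg_sub])
  exists_half X := ⟨(2 : F)⁻¹ • X, by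
    rw [← add_smul, ← two_mul, mul_inv_cancel₀ h2, one_smul]⟩
  equiv_mul g h := by
    obtain ⟨a, rfl⟩ := (coordEquiv hstar h2 G hG).surjective g
    obtain ⟨b, rfl⟩ := (coordEquiv hstar h2 G hG).surjective h
    rw [Equiv.symm_apply_eq]
    simp only [Equiv.symm_apply_apply]
    exact Subtype.ext (Units.ext (coordMat_mul h2 a b))

end Radical

lemma sq_pow_mul_pow_eq_iff {q : ℕ} (hq : 1 < q) (d e k m : ℕ) :
    ((q ^ 2) ^ e) ^ 2 * (q ^ 2) ^ (k * (m + m)) = (q ^ 2) ^ (d * (m + m)) ↔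
      e + m * k = d * m := by
  rw [← pow_mul, ← pow_mul, ← pow_mul, ← pow_mul, ← pow_add, Nat.pow_right_inj hq]
  constructor <;> intro h <;> nlinarith

/-- for fixed `n, d, e`, there is a polynomial `P` with non-negative integer
coefficients such that for every power `q` of an odd prime, the number of irreducible
characters of `R_u^{U,d}` over `F_{q²}` of degree `(q²)^e` equals `P(q−1)`. -/
theorem ruU_char_count_polynomial
    (n d e : ℕ) (hd : 1 ≤ d) (hdn : d ≤ n - 1) :
    ∃ P : Polynomial ℕ, ∀ (p k q : ℕ), p.Prime → Odd p → 1 ≤ k → q = p ^ k →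
      ∀ (F : Type) [Field F] [Fintype F], Fintype.card F = q ^ 2 →
      ∀ (G : Subgroup (Matrix (κ n d) (κ n d) F)ˣ),
        (∀ u : (Matrix (κ n d) (κ n d) F)ˣ,
          u ∈ G ↔ (u : Matrix (κ n d) (κ n d) F) ∈ RuU q F n d) →
        Nat.card {χ : ↥G → ℂ |
            (∃ V : FDRep ℂ ↥G, CategoryTheory.Simple V ∧ FDRep.character V = χ) ∧
            χ 1 = ((q : ℂ) ^ 2) ^ e} = P.eval (q - 1) := by
  choose P hP using fun k => exists_polynomial_hermitianCount d k
  refine ⟨∑ k ∈ Finset.range (d + 1), if e + (n - d) * k = d * (n - d) then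
    P k * (Polynomial.X + 1) ^ (4 * (n - d) * k) else 0, ?_⟩
  intro p k q hp hodd hk hq F _ _ hF G hG
  have hq1 : 1 < q := hq ▸ Nat.one_lt_pow (by omega) hp.one_lt
  have hF' : Nat.card F = q ^ 2 := by rw [Nat.card_eq_fintype_card, hF]
  have h2 : (2 : F) ≠ 0 := by
    have := Fact.mk hp
    have hc : CharP F p := charP_of_card_eq_prime_pow (f := k * 2) (by rw [hF, hq, pow_mul])
    exact Ring.two_ne_zero (ringChar.eq F p ▸ hodd.ne_two_of_dvd_nat dvd_rfl)
  let _ : StarRing F := starRingOfCard hp hq hF'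
  have hstar : ∀ x : F, star x = x ^ q := fun _ => rfl
  obtain ⟨x, hx⟩ := exists_pow_ne_self hq1 hF
  obtain ⟨ε, hε, hε0⟩ := exists_star_eq_neg hx
  have hsa := card_selfAdjoint hF' h2 hε hε0
  have hD : ((q : ℂ) ^ 2) ^ e = (((q ^ 2) ^ e : ℕ) : ℂ) := by push_cast; rfl
  have hfin : Finite G := inferInstance
  rw [hD, card_irreducible_characters_skewCocycle (middleForm_isHermitian F (n - d))
    (middleForm_isUnit F (n - d)) h2 hε hε0 (radicalCoords hstar h2 G hG) rfl, hF',
    Polynomial.eval_finsetSum]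
  refine Finset.sum_congr rfl fun j _ => ?_
  rw [Fintype.card_sum, Fintype.card_fin]
  simp only [sq_pow_mul_pow_eq_iff hq1]
  split_ifs with h
  · rw [hP j q F hsa hF', Polynomial.eval_mul, Polynomial.eval_pow, Polynomial.eval_add,
      Polynomial.eval_X, Polynomial.eval_one, Nat.sub_add_cancel hq1.le, ← pow_mul]
    congr 2
    ring
  · simp

end UnitaryUnipotentRadical
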